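/- Let π and π' be two stationary stochastic policies for a finite MDP and let ρ0 be any initial distribution on S. Then for every t ≥ 0, the time-t state distributions satisfy D_TV(d^π_t ‖ d^{π'}_t) ≤ t · max_{s∈S} D_TV(π(·|s) ‖ π'(·|s)). -/

import Mathlib

/-- Total variation distance between two probability mass functions on a finite set. -/
noncomputable def tv {X : Type*} [Fintype X] (p q : X → ℝ) : ℝ :=
  (1 / 2) * ∑ x, |p x - q x|

/-- `p` is a probability mass function on a finite set. -/
def IsPMF {X : Type*} [Fintype X] (p : X → ℝ) : Prop :=
  (∀ x, 0 ≤ p x) ∧ ∑ x, p x = 1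

/-- Time-`t` state distribution `d^π_t` of policy `π` started from `ρ0`. -/
noncomputable def stateDist {S A : Type*} [Fintype S] [Fintype A]
    (ρ : S → A → S → ℝ) (π : S → A → ℝ) (ρ0 : S → ℝ) : ℕ → S → ℝ
  | 0 => ρ0
  | t + 1 => fun s' => ∑ s, ∑ a, (stateDist ρ π ρ0 t s * π s a) * ρ s a s'

/-- Time-`t` state–action distribution `p^π_t` of policy `π` started from `ρ0`. -/
noncomputable def saDist {S A : Type*} [Fintype S] [Fintype A]
    (ρ : S → A → S → ℝ) (π : S → A → ℝ) (ρ0 : S → ℝ) (t : ℕ) : S × A → ℝ :=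
  fun sa => stateDist ρ π ρ0 t sa.1 * π sa.1 sa.2

/-- Discounted return `J^π = Σ_t γ^t Σ_{(s,a)} p^π_t(s,a) r(s,a)`. -/
noncomputable def discReturn {S A : Type*} [Fintype S] [Fintype A]
    (ρ : S → A → S → ℝ) (π : S → A → ℝ) (ρ0 : S → ℝ) (r : S → A → ℝ) (γ : ℝ) : ℝ :=
  ∑' t : ℕ, γ ^ t * ∑ s, ∑ a, saDist ρ π ρ0 t (s, a) * r s a

/-- The state distributions are probability mass functions. -/
theorem stateDist_isPMF_aux
    {S A : Type*} [Fintype S] [Fintype A]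
    (ρ : S → A → S → ℝ) (hρ : ∀ s a, IsPMF (ρ s a))
    (π : S → A → ℝ) (hπ : ∀ s, IsPMF (π s))
    (ρ0 : S → ℝ) (hρ0 : IsPMF ρ0) (t : ℕ) : IsPMF (stateDist ρ π ρ0 t) := by
  induction t with
  | zero => exact hρ0
  | succ t ih =>
    refine ⟨fun s' => Finset.sum_nonneg fun s _ => Finset.sum_nonneg fun a _ =>
      mul_nonneg (mul_nonneg (ih.1 s) ((hπ s).1 a)) ((hρ s a).1 s'), ?_⟩
    simp only [stateDist]
    rw [Finset.sum_comm]
    rw [← ih.2]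
    refine Finset.sum_congr rfl fun s _ => ?_
    rw [Finset.sum_comm]
    simp only [← Finset.mul_sum, (hρ s _).2, mul_one, (hπ s).2]

/-- **State-distribution TV bound.** For policies `π, π'` of a finite MDP and any initial
distribution `ρ0`, for every `t ≥ 0`:
`D_TV(d^π_t ‖ d^{π'}_t) ≤ t · max_s D_TV(π(·|s) ‖ π'(·|s))`. -/
theorem stateDist_tv_le
    {S A : Type*} [Fintype S] [Nonempty S] [Fintype A] [Nonempty A]
    (ρ : S → A → S → ℝ) (hρ : ∀ s a, IsPMF (ρ s a))
    (r : S → A → ℝ) (γ : ℝ) (hγ0 : 0 < γ) (hγ1 : γ < 1)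
    (π π' : S → A → ℝ) (hπ : ∀ s, IsPMF (π s)) (hπ' : ∀ s, IsPMF (π' s))
    (ρ0 : S → ℝ) (hρ0 : IsPMF ρ0) (t : ℕ) :
    tv (stateDist ρ π ρ0 t) (stateDist ρ π' ρ0 t) ≤
      (t : ℝ) * Finset.univ.sup' Finset.univ_nonempty (fun s => tv (π s) (π' s)) := by
  set M := Finset.univ.sup' Finset.univ_nonempty (fun s => tv (π s) (π' s)) with hM
  induction t with
  | zero => simp [stateDist, tv]
  | succ t ih =>
    have hd := stateDist_isPMF_aux ρ hρ π hπ ρ0 hρ0 t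
    set d := stateDist ρ π ρ0 t with hdd
    set d' := stateDist ρ π' ρ0 t with hdd'
    have key : ∑ s', |stateDist ρ π ρ0 (t + 1) s' - stateDist ρ π' ρ0 (t + 1) s'| ≤
        ∑ s, (d s * ∑ a, |π s a - π' s a| + |d s - d' s|) := by
      calc _ ≤ ∑ s', ∑ s, ∑ a, (d s * |π s a - π' s a| + |d s - d' s| * π' s a) * ρ s a s' := by
            refine Finset.sum_le_sum fun s' _ => ?_
            simp only [stateDist, ← hdd, ← hdd', ← Finset.sum_sub_distrib]
            refine (Finset.abs_sum_le_sum_abs _ _).trans (Finset.sum_le_sum fun s _ => ?_)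
            refine (Finset.abs_sum_le_sum_abs _ _).trans (Finset.sum_le_sum fun a _ => ?_)
            rw [← sub_mul, abs_mul, abs_of_nonneg ((hρ s a).1 s')]
            refine mul_le_mul_of_nonneg_right ?_ ((hρ s a).1 s')
            have h : d s * π s a - d' s * π' s a
                = d s * (π s a - π' s a) + (d s - d' s) * π' s a := by ring
            rw [h]
            refine (abs_add_le _ _).trans (le_of_eq ?_)
            rw [abs_mul, abs_mul, abs_of_nonneg (hd.1 s), abs_of_nonneg ((hπ' s).1 a)]
        _ = _ := by
            rw [Finset.sum_comm]
            refine Finset.sum_congr rfl fun s _ => ?_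
            rw [Finset.sum_comm]
            simp only [← Finset.mul_sum, (hρ s _).2, mul_one, Finset.sum_add_distrib, (hπ' s).2]
    have h1 : ∑ s, d s * ((1 / 2) * ∑ a, |π s a - π' s a|) ≤ M := by
      calc _ ≤ ∑ s, d s * M := Finset.sum_le_sum fun s _ =>
            mul_le_mul_of_nonneg_left
              (Finset.le_sup' (fun s => tv (π s) (π' s)) (Finset.mem_univ s)) (hd.1 s)
        _ = M := by rw [← Finset.sum_mul, hd.2, one_mul]
    have h2 : ∑ s, d s * ((1 / 2) * ∑ a, |π s a - π' s a|)
        = (1 / 2) * ∑ s, d s * ∑ a, |π s a - π' s a| := by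
      rw [Finset.mul_sum]
      exact Finset.sum_congr rfl fun s _ => by ring
    rw [Finset.sum_add_distrib] at key
    unfold tv at ih ⊢
    push_cast
    linarith
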